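/- For every fixed even integer ℓ ≥ 2 there exist a constant c = c(ℓ) > 0 and an integer t_0 = t_0(ℓ) such that for every integer t ≥ t_0 there is an integer n_0 = n_0(ℓ, t) with the following property: for every n ≥ n_0 there exists a Θ_{ℓ,t}-free graph on n vertices with at least c · t^{1/ℓ} · n^{1+1/ℓ} edges. -/

import Mathlib

/-- `G` contains the theta graph `Θ_{ℓ,t}`: there are two distinct vertices `x, y`
joined by `t` paths of length exactly `ℓ`, any two of which share no vertices
other than `x` and `y`. -/
def SimpleGraph.HasTheta {V : Type*} (G : SimpleGraph V) (ℓ t : ℕ) : Prop :=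
  ∃ (x y : V) (p : Fin t → Fin (ℓ + 1) → V),
    x ≠ y ∧
    (∀ i, p i 0 = x) ∧
    (∀ i, p i (Fin.last ℓ) = y) ∧
    (∀ i, Function.Injective (p i)) ∧
    (∀ i (j : Fin ℓ), G.Adj (p i j.castSucc) (p i j.succ)) ∧
    (∀ i i', i ≠ i' → ∀ j j', p i j = p i' j' → p i j = x ∨ p i j = y)

open Filter

theorem exists_ultraproduct (F : ℕ → Type) [∀ j, Field (F j)] :
    ∃ (K : Type) (_ : Field K) (φ : (∀ j, F j) →+* K),
      (∀ r, (∀ᶠ j in atTop, r j = 0) → φ r = 0) ∧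
      ∀ (ι : Type) [Fintype ι] (r : ι → ∀ j, F j),
        (∀ᶠ j in atTop, ∃ i, r i j ≠ 0) → ∃ i, φ (r i) ≠ 0 := by
  classical
  let I : Ideal (∀ j, F j) :=
    { carrier := {r | ∀ᶠ j in atTop, r j = 0}
      add_mem' := fun {a b} ha hb => by
        filter_upwards [ha, hb] with j h1 h2
        simp [h1, h2]
      zero_mem' := by simp
      smul_mem' := fun a b hb => by
        filter_upwards [hb] with j h
        simp [h] }
  have hI : I ≠ ⊤ := by
    intro h
    have h1 : (1 : ∀ j, F j) ∈ I := h ▸ Submodule.mem_top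
    have h2 : ∀ᶠ j in atTop, (1 : ∀ j, F j) j = 0 := h1
    obtain ⟨j, hj⟩ := h2.exists
    simp at hj
  obtain ⟨M, hM, hIM⟩ := Ideal.exists_le_maximal I hI
  let _ : Field ((∀ j, F j) ⧸ M) := Ideal.Quotient.field M
  have key : ∀ r : ∀ j, F j, (∀ᶠ j in atTop, r j = 0) → Ideal.Quotient.mk M r = 0 :=
    fun r hr => Ideal.Quotient.eq_zero_iff_mem.2 (hIM hr)
  refine ⟨(∀ j, F j) ⧸ M, inferInstance, Ideal.Quotient.mk M, key, ?_⟩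
  intro ι _ r hr
  by_contra! hcon
  have h1 : Ideal.Quotient.mk M (∏ i, (1 - r i * fun j => (r i j)⁻¹)) = 0 := by
    apply key
    filter_upwards [hr] with j hj
    obtain ⟨i, hi⟩ := hj
    rw [Finset.prod_apply]
    exact Finset.prod_eq_zero (Finset.mem_univ i) (by simp [hi])
  rw [map_prod] at h1
  simp [hcon] at h1

theorem AlgebraicIndependent.card_le_of_mem_closure {k : Type*} [Field k] {I J : Type*} [Fintype I]
    [Fintype J] {c : I → k} (hc : AlgebraicIndependent ℤ c) (g : J → k)
    (h : ∀ i, c i ∈ Subfield.closure (Set.range g)) : Fintype.card I ≤ Fintype.card J := by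
  classical
  have : FaithfulSMul ℤ k := (faithfulSMul_iff_algebraMap_injective ℤ k).2 hc.algebraMap_injective
  let M := AlgebraicIndependent.matroid ℤ k
  have hind : M.Indep (Set.range c) := AlgebraicIndependent.matroid_indep_iff.2 hc.coe_range
  have hsub : Set.range c ⊆ M.closure (Set.range g) := by
    rintro _ ⟨i, rfl⟩
    have hmem := h i
    generalize c i = y at hmem ⊢
    simp only [M, AlgebraicIndependent.matroid_closure_eq]
    induction hmem using Subfield.closure_induction with
    | mem x hx => exact isAlgebraic_algebraMap (⟨x, Algebra.subset_adjoin hx⟩ : Algebra.adjoin ℤ _)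
    | one => exact isAlgebraic_one
    | add x y _ _ hx hy => exact IsAlgebraic.add hx hy
    | neg x _ hx => exact IsAlgebraic.neg hx
    | inv x _ hx => exact IsAlgebraic.inv hx
    | mul x y _ _ hx hy => exact IsAlgebraic.mul hx hy
  have h1 : M.eRk (Set.range c) ≤ M.eRk (Set.range g) := by
    rw [← M.eRk_closure_eq (Set.range g)]
    exact M.eRk_mono hsub
  rw [hind.eRk_eq_encard] at h1
  have h2 := h1.trans (M.eRk_le_encard _)
  have h3 : (Set.range c).encard = Fintype.card I := by
    rw [← Set.image_univ, hc.injective.injOn.encard_image, Set.encard_univ,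
      ENat.card_eq_coe_fintype_card]
  have h4 : (Set.range g).encard ≤ Fintype.card J := by
    rw [← Set.image_univ]
    refine (Set.encard_image_le _ _).trans ?_
    rw [Set.encard_univ,
      ENat.card_eq_coe_fintype_card]
  rw [h3] at h2
  exact_mod_cast h2.trans h4

theorem exists_specialization {k L : Type*} [Field k] [IsAlgClosed k] [Field L] [Algebra k L]
    (A : Subalgebra k L) (hA : A.FG) (z : A) (hz : Transcendental k z) :
    ∃ f : Polynomial k, f ≠ 0 ∧ ∀ a, f.eval a ≠ 0 → ∃ φ : A →ₐ[k] k, φ z = a := by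
  let ψ : Polynomial k →ₐ[k] A := Polynomial.aeval z
  have hψ : Function.Injective ψ := transcendental_iff_injective.1 hz
  have hft : Algebra.FiniteType k A := A.fg_iff_finiteType.1 hA
  have hfin : (ψ : Polynomial k →+* A).FiniteType := by
    refine RingHom.FiniteType.of_comp_finiteType (f := (Polynomial.C : k →+* Polynomial k)) ?_
    have : (ψ : Polynomial k →+* A).comp Polynomial.C = algebraMap k A := by
      ext x; simp [ψ]
    rw [this]
    exact RingHom.finiteType_algebraMap.2 hft
  have hfp : (ψ : Polynomial k →+* A).FinitePresentation :=
    RingHom.FinitePresentation.of_finiteType.1 hfin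
  obtain ⟨T, hT⟩ := PrimeSpectrum.exists_constructibleSetData_iff.mpr
    (PrimeSpectrum.isConstructible_range_comap hfp)
  have hbot : (⊥ : PrimeSpectrum (Polynomial k)) ∈ T.toSet := by
    rw [hT]
    refine ⟨⊥, ?_⟩
    ext x
    have := map_eq_zero_iff ψ hψ (x := x)
    simpa using this
  simp only [PrimeSpectrum.ConstructibleSetData.toSet, Set.mem_iUnion] at hbot
  obtain ⟨C, hC, hb⟩ := hbot
  refine ⟨C.f, ?_, ?_⟩
  · have := hb.2
    simpa [PrimeSpectrum.mem_zeroLocus] using this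
  · intro a ha
    have hp : (Ideal.span {Polynomial.X - Polynomial.C a}).IsPrime :=
      (Ideal.span_singleton_prime (Polynomial.X_sub_C_ne_zero a)).2 (Polynomial.prime_X_sub_C a)
    have hmem : (⟨_, hp⟩ : PrimeSpectrum (Polynomial k)) ∈ T.toSet := by
      simp only [PrimeSpectrum.ConstructibleSetData.toSet, Set.mem_iUnion]
      refine ⟨C, hC, ?_, ?_⟩
      · have h1 := hb.1
        rw [PrimeSpectrum.mem_zeroLocus] at h1 ⊢
        intro x hx
        have := h1 hx
        simp at this
        simp [this]
      · rw [PrimeSpectrum.mem_zeroLocus]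
        intro h
        have := h (Set.mem_singleton _)
        rw [SetLike.mem_coe, Ideal.mem_span_singleton, Polynomial.dvd_iff_isRoot] at this
        exact ha this
    rw [hT] at hmem
    obtain ⟨q, hq⟩ := hmem
    obtain ⟨m, hm, hqm⟩ := Ideal.exists_le_maximal q.asIdeal q.2.ne_top
    let _ : Field (A ⧸ m) := Ideal.Quotient.field m
    have : Algebra.FiniteType k (A ⧸ m) := 
      Algebra.FiniteType.of_surjective (Ideal.Quotient.mkₐ k m) (Ideal.Quotient.mkₐ_surjective k m)
    have : Module.Finite k (A ⧸ m) := finite_of_finite_type_of_isJacobsonRing k (A ⧸ m)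
    have hbij : Function.Bijective (algebraMap k (A ⧸ m)) :=
      IsAlgClosed.algebraMap_bijective_of_isIntegral
    let e : k ≃ₐ[k] (A ⧸ m) := AlgEquiv.ofBijective (Algebra.ofId k (A ⧸ m)) hbij
    refine ⟨e.symm.toAlgHom.comp (Ideal.Quotient.mkₐ k m), ?_⟩
    have hza : z - algebraMap k A a ∈ m := by
      apply hqm
      have h1 : (Polynomial.X - Polynomial.C a) ∈
          (PrimeSpectrum.comap (ψ : Polynomial k →+* A) q).asIdeal := by
        rw [hq]; exact Ideal.mem_span_singleton_self _
      have h2 : ψ (Polynomial.X - Polynomial.C a) ∈ q.asIdeal := h1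
      simpa [ψ] using h2
    have h3 : Ideal.Quotient.mkₐ k m z = algebraMap k (A ⧸ m) a := by
      have := Ideal.Quotient.eq.2 hza
      simpa using this
    change e.symm (Ideal.Quotient.mkₐ k m z) = a
    rw [h3]
    exact e.symm.commutes a

theorem exists_injective_forall_mem_subfield {k E I : Type*} [Field k] [Fintype E] [Fintype I]
    (M : Matrix E I k) (hM : LinearIndependent k M) :
    ∃ a : E → I, Function.Injective a ∧ ∀ F : Subfield k, (∀ e i, M e i ∈ F) →
      ∀ (τ : E → k) (c : I → k), (∀ e, τ e ∈ F) → (∀ e, ∑ i, M e i * c i = τ e) →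
        (∀ i ∉ Set.range a, c i ∈ F) → ∀ i, c i ∈ F := by
  classical
  have hspan : Submodule.span k (Set.range M.col) = ⊤ := by
    apply Submodule.eq_top_of_finrank_eq
    rw [← Matrix.rank_eq_finrank_span_cols, LinearIndependent.rank_matrix hM,
      Module.finrank_fintype_fun_eq_card]
  obtain ⟨κ, b, hb, hbs, hbl⟩ := exists_linearIndependent' k M.col
  have : Finite κ := Finite.of_injective b hb
  have : Fintype κ := Fintype.ofFinite κ
  have hcard : Fintype.card E = Fintype.card κ := by
    let B := Module.Basis.mk hbl (by rw [hbs, hspan])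
    rw [← Module.finrank_eq_card_basis B, Module.finrank_fintype_fun_eq_card]
  let e := Fintype.equivOfCardEq hcard
  let a : E → I := b ∘ e
  have ha : Function.Injective a := hb.comp e.injective
  refine ⟨a, ha, ?_⟩
  let N : Matrix E E k := M.submatrix id a
  have hN : IsUnit N := by
    rw [← Matrix.linearIndependent_cols_iff_isUnit]
    exact hbl.comp e e.injective
  intro F hF τ c hτ hc hcF
  let w : E → k := fun e => τ e - ∑ i ∈ Finset.univ.filter (· ∉ Set.range a), M e i * c i
  have hw : ∀ e, w e ∈ F := fun e =>
    F.sub_mem (hτ e) (F.sum_mem fun i hi => F.mul_mem (hF e i) (hcF i (by simpa using hi)))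
  have hNw : N.mulVec (c ∘ a) = w := by
    ext e'
    simp only [w, ← hc e', Matrix.mulVec, dotProduct]
    rw [eq_sub_iff_add_eq, ← Finset.sum_filter_add_sum_filter_not Finset.univ (· ∈ Set.range a)
      (fun i => M e' i * c i)]
    congr 1
    rw [show Finset.univ.filter (· ∈ Set.range a) = Finset.univ.image a by ext; simp,
      Finset.sum_image ha.injOn]
    rfl
  let N' : Matrix E E F := fun e e' => ⟨N e e', hF _ _⟩
  let w' : E → F := fun e => ⟨w e, hw e⟩
  have hNN' : N'.map F.subtype = N := rfl
  have hdet : IsUnit N'.det := by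
    rw [isUnit_iff_ne_zero]
    intro h
    have h1 : N.det = 0 := by
      rw [← hNN', ← RingHom.mapMatrix_apply, ← RingHom.map_det, h, map_zero]
    exact ((Matrix.isUnit_iff_isUnit_det N).1 hN).ne_zero h1
  have hsol : N.mulVec (F.subtype ∘ (N'⁻¹.mulVec w')) = w := by
    have h1 := RingHom.map_mulVec F.subtype N' (N'⁻¹.mulVec w')
    ext i
    rw [← hNN', ← h1 i, Matrix.mulVec_mulVec, Matrix.mul_nonsing_inv _ hdet, Matrix.one_mulVec]
    rfl
  have heq := Matrix.mulVec_injective_of_isUnit hN (hNw.trans hsol.symm)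
  intro i
  by_cases hi : i ∈ Set.range a
  · obtain ⟨e', rfl⟩ := hi
    have := congrFun heq e'
    simp only [Function.comp_apply] at this
    rw [this]
    exact SetLike.coe_mem _
  · exact hcF i hi

theorem linearIndependent_monomial_eval {k E : Type*} [Field k] [Fintype E] {N D : ℕ}
    (q : E → Fin N → k) (hq : Function.Injective q) (hD : Fintype.card E ≤ D) :
    LinearIndependent k (fun e (α : Fin N → Fin D) => ∏ i, q e i ^ (α i : ℕ)) := by
  classical
  rw [Fintype.linearIndependent_iff]
  intro g hg e
  have hf : ∀ e', ∃ f : MvPolynomial (Fin N) k, (∀ i, f.degreeOf i ≤ 1) ∧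
      MvPolynomial.eval (q e') f = 0 ∧ (e' ≠ e → MvPolynomial.eval (q e) f ≠ 0) := by
    intro e'
    by_cases he : e' = e
    · exact ⟨0, by simp, by simp, fun h => absurd he h⟩
    · obtain ⟨κ, hκ⟩ := Function.ne_iff.1 (hq.ne he)
      refine ⟨MvPolynomial.X κ - MvPolynomial.C (q e' κ), fun i => ?_, by simp, fun _ => ?_⟩
      · refine (MvPolynomial.degreeOf_sub_le _ _ _).trans ?_
        rw [MvPolynomial.degreeOf_C, MvPolynomial.degreeOf_X]
        split_ifs <;> simp
      · simpa [sub_eq_zero] using hκ.symm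
  choose f hfdeg hfz hfn using hf
  let P : MvPolynomial (Fin N) k := ∏ e' ∈ Finset.univ.erase e, f e'
  have hdeg : ∀ i, P.degreeOf i < D := by
    intro i
    refine lt_of_le_of_lt (MvPolynomial.degreeOf_prod_le _ _ _) ?_
    refine lt_of_le_of_lt (Finset.sum_le_card_nsmul _ _ 1 fun e' _ => hfdeg e' i) ?_
    rw [Finset.card_erase_of_mem (Finset.mem_univ e), Finset.card_univ]
    have : 0 < Fintype.card E := Fintype.card_pos_iff.2 ⟨e⟩
    simp only [smul_eq_mul, mul_one]
    omega
  have hsum : ∑ e', g e' * MvPolynomial.eval (q e') P = 0 := by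
    simp_rw [MvPolynomial.eval_eq', Finset.mul_sum]
    rw [Finset.sum_comm]
    refine Finset.sum_eq_zero fun d hd => ?_
    have h1 := congrFun hg fun i =>
      ⟨d i, lt_of_le_of_lt (MvPolynomial.monomial_le_degreeOf i hd) (hdeg i)⟩
    simp only [Finset.sum_apply, Pi.smul_apply, smul_eq_mul, Pi.zero_apply] at h1
    calc _ = MvPolynomial.coeff d P * ∑ e', g e' * ∏ i, q e' i ^ d i := by
          rw [Finset.mul_sum]
          exact Finset.sum_congr rfl fun _ _ => by ring
      _ = 0 := by rw [h1, mul_zero]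
  rw [Finset.sum_eq_single e] at hsum
  · refine (mul_eq_zero.1 hsum).resolve_right ?_
    rw [map_prod]
    exact Finset.prod_ne_zero_iff.2 fun e' he' => hfn e' (Finset.ne_of_mem_erase he')
  · intro e' _ he'
    rw [map_prod, Finset.prod_eq_zero (Finset.mem_erase.2 ⟨he', Finset.mem_univ _⟩) (hfz e'),
      mul_zero]
  · simp

/-- The `κ`-th coordinate of the line through the point `p` with colour `σ` and first coordinate
`b`, for the algebraic graph with coefficients `c`. -/
def lineCoord {R : Type*} [CommRing R] {m D : ℕ} (c : Fin m → (Fin (m + 3) → Fin D) → R)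
    (p : Fin (m + 1) → R) (b σ : R) (κ : Fin m) : R :=
  σ * p 0 ^ D + ∑ α, c κ α * ∏ i, (Fin.cons σ (Fin.cons b p) : Fin (m + 3) → R) i ^ (α i : ℕ)

/-- The point `p` and the line `l` are joined by an edge of colour `σ`. -/
def Incident {R : Type*} [CommRing R] {m D : ℕ} (c : Fin m → (Fin (m + 3) → Fin D) → R)
    (p l : Fin (m + 1) → R) (σ : R) : Prop :=
  ∀ κ : Fin m, l κ.succ = lineCoord c p (l 0) σ κ

/-- The position of the point on the `j`-th edge of an alternating walk, which starts at a point
if `b` is true and at a line otherwise. -/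
def pointIdx {n : ℕ} (b : Bool) (j : Fin n) : Fin (n + 1) :=
  if Even (j : ℕ) ↔ b = true then j.castSucc else j.succ

/-- The position of the line on the `j`-th edge of an alternating walk, which starts at a point
if `b` is true and at a line otherwise. -/
def lineIdx {n : ℕ} (b : Bool) (j : Fin n) : Fin (n + 1) :=
  if Even (j : ℕ) ↔ b = true then j.succ else j.castSucc

/-- The sequence `v` alternates between points and lines, consecutive terms are joined by edges
with the prescribed colours, and no point and no line is repeated. -/
structure IsColoredPath {R : Type*} [CommRing R] {m D : ℕ}
    (c : Fin m → (Fin (m + 3) → Fin D) → R) (b : Bool) (σ : Fin (m + 1) → R)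
    (v : Fin (m + 2) → Fin (m + 1) → R) : Prop where
  incident : ∀ j, Incident c (v (pointIdx b j)) (v (lineIdx b j)) (σ j)
  inj : ∀ a a' : Fin (m + 2), (a : ℕ) % 2 = a' % 2 → v a = v a' → a = a'

theorem pointIdx_mod_two {n : ℕ} (b : Bool) (j j' : Fin n) :
    (pointIdx b j : ℕ) % 2 = (pointIdx b j' : ℕ) % 2 := by
  simp only [pointIdx, Nat.even_iff]
  cases b <;> split_ifs <;> simp_all <;> omega

theorem lineIdx_mod_two {n : ℕ} (b : Bool) (j j' : Fin n) :
    (lineIdx b j : ℕ) % 2 = (lineIdx b j' : ℕ) % 2 := by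
  simp only [lineIdx, Nat.even_iff]
  cases b <;> split_ifs <;> simp_all <;> omega

theorem pointIdx_add_lineIdx {n : ℕ} (b : Bool) (j : Fin n) :
    (pointIdx b j : ℕ) + lineIdx b j = 2 * j + 1 := by
  simp only [pointIdx, lineIdx]
  split_ifs <;> simp <;> omega

theorem exists_interior_idx {n : ℕ} (hn : 2 ≤ n) (b : Bool) (j : Fin n) :
    (pointIdx b j ≠ 0 ∧ pointIdx b j ≠ Fin.last n) ∨
      (lineIdx b j ≠ 0 ∧ lineIdx b j ≠ Fin.last n) := by
  have := j.2
  simp only [pointIdx, lineIdx, ne_eq, Fin.ext_iff]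
  split_ifs <;> simp <;> omega

theorem Incident.eq_of_cons_eq {R : Type*} [CommRing R] {m D : ℕ}
    {c : Fin m → (Fin (m + 3) → Fin D) → R} {p l p' l' : Fin (m + 1) → R} {σ σ' : R}
    (h : Incident c p l σ) (h' : Incident c p' l' σ')
    (heq : (Fin.cons σ (Fin.cons (l 0) p) : Fin (m + 3) → R) = Fin.cons σ' (Fin.cons (l' 0) p')) :
    p = p' ∧ l = l' := by
  obtain ⟨h1, h2⟩ := Fin.cons_injective2 heq
  obtain ⟨h3, h4⟩ := Fin.cons_injective2 h2
  refine ⟨h4, ?_⟩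
  ext κ
  refine Fin.cases h3 (fun κ => ?_) κ
  rw [h κ, h' κ, h1, h3, h4]

theorem card_le_of_coloredPaths {k : Type*} [Field k] {m D s : ℕ} (hm : 1 ≤ m)
    (hD : s * (m + 1) ≤ D) {c : Fin m → (Fin (m + 3) → Fin D) → k}
    (hc : AlgebraicIndependent ℤ fun i : Fin m × (Fin (m + 3) → Fin D) => c i.1 i.2)
    {b : Bool} {σ : Fin (m + 1) → k} {x y : Fin (m + 1) → k}
    {P : Fin s → Fin (m + 2) → Fin (m + 1) → k} (hP : ∀ i, IsColoredPath c b σ (P i))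
    (hx : ∀ i, P i 0 = x) (hy : ∀ i, P i (Fin.last _) = y)
    (hdisj : ∀ i i', i ≠ i' → ∀ a a' : Fin m, P i a.succ.castSucc ≠ P i' a'.succ.castSucc)
    {a₀ : Fin m} {κ₀ : Fin (m + 1)} (hn : ∀ i, ∃ n : ℕ, P i a₀.succ.castSucc κ₀ = n) :
    s ≤ 3 * (m + 1) := by
  classical
  have hcases : ∀ t : Fin (m + 2), t = 0 ∨ t = Fin.last _ ∨ ∃ a : Fin m, t = a.succ.castSucc := by
    intro t
    refine Fin.lastCases (Or.inr (Or.inl rfl)) (fun t => ?_) t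
    refine Fin.cases (Or.inl rfl) (fun a => Or.inr (Or.inr ⟨a, rfl⟩)) t
  have hinj : ∀ i i' (t t' : Fin (m + 2)), (t : ℕ) % 2 = t' % 2 → P i t = P i' t' →
      t = t' ∧ (t ≠ 0 → t ≠ Fin.last _ → i = i') := by
    intro i i' t t' hpar heq
    by_cases hi : i = i'
    · subst hi
      exact ⟨(hP i).inj _ _ hpar heq, fun _ _ => rfl⟩
    · rcases hcases t' with rfl | rfl | ⟨a', rfl⟩
      · have := (hP i).inj _ _ hpar (heq.trans ((hx i').trans (hx i).symm))
        exact ⟨this, fun h => absurd this h⟩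
      · have := (hP i).inj _ _ hpar (heq.trans ((hy i').trans (hy i).symm))
        exact ⟨this, fun _ h => absurd this h⟩
      · rcases hcases t with rfl | rfl | ⟨a, rfl⟩
        · have := (hP i').inj _ _ hpar (((hx i').trans (hx i).symm).trans heq)
          exact ⟨this, fun h => absurd rfl h⟩
        · have := (hP i').inj _ _ hpar (((hy i').trans (hy i).symm).trans heq)
          exact ⟨this, fun _ h => absurd rfl h⟩
        · exact absurd heq (hdisj i i' hi a a')
  let E := Fin s × Fin (m + 1)
  let pt : E → Fin (m + 1) → k := fun e => P e.1 (pointIdx b e.2)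
  let ln : E → Fin (m + 1) → k := fun e => P e.1 (lineIdx b e.2)
  have hinc : ∀ e : E, Incident c (pt e) (ln e) (σ e.2) := fun e => (hP e.1).incident e.2
  let q : E → Fin (m + 3) → k := fun e => Fin.cons (σ e.2) (Fin.cons (ln e 0) (pt e))
  have hq : Function.Injective q := by
    rintro ⟨i, j⟩ ⟨i', j'⟩ heq
    obtain ⟨h1, h2⟩ := (hinc (i, j)).eq_of_cons_eq (hinc (i', j')) heq
    obtain ⟨h3, h4⟩ := hinj _ _ _ _ (pointIdx_mod_two b j j') h1
    obtain ⟨h5, h6⟩ := hinj _ _ _ _ (lineIdx_mod_two b j j') h2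
    have h7 := pointIdx_add_lineIdx b j
    have h8 := pointIdx_add_lineIdx b j'
    have hj : j = j' := by
      rw [h3, h5, h8] at h7
      ext; omega
    have hi : i = i' := by
      rcases exists_interior_idx (n := m + 1) (by omega) b j with h | h
      · exact h4 h.1 h.2
      · exact h6 h.1 h.2
    rw [hi, hj]
  have hcardE : Fintype.card E = s * (m + 1) := by simp [E]
  obtain ⟨a, ha, hsolve⟩ := exists_injective_forall_mem_subfield _
    (linearIndependent_monomial_eval (D := D) q hq (hcardE.trans_le hD))
  let J := (Fin 3 × Fin (m + 1)) ⊕ (Fin s × {u : Fin m × Fin (m + 1) // u ≠ (a₀, κ₀)}) ⊕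
    (Fin m × {α : Fin (m + 3) → Fin D // α ∉ Set.range a})
  let g : J → k := Sum.elim (fun u => ![x, y, σ] u.1 u.2)
    (Sum.elim (fun u => P u.1 u.2.1.1.succ.castSucc u.2.1.2) fun u => c u.1 u.2.1)
  let F := Subfield.closure (Set.range g)
  have hg : ∀ j, g j ∈ F := fun j => Subfield.subset_closure ⟨j, rfl⟩
  have hFP : ∀ i t κ, P i t κ ∈ F := by
    intro i t κ
    rcases hcases t with rfl | rfl | ⟨a, rfl⟩
    · rw [hx]; exact hg (Sum.inl (0, κ))
    · rw [hy]; exact hg (Sum.inl (1, κ))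
    · by_cases h : (a, κ) = (a₀, κ₀)
      · obtain ⟨rfl, rfl⟩ := Prod.ext_iff.1 h
        obtain ⟨n, hn⟩ := hn i
        simp only at hn
        rw [hn]
        exact natCast_mem F n
      · exact hg (Sum.inr (Sum.inl (i, ⟨(a, κ), h⟩)))
  have hFσ : ∀ j, σ j ∈ F := fun j => hg (Sum.inl (2, j))
  have hFq : ∀ e i, q e i ∈ F := by
    intro e i
    refine Fin.cases (hFσ _) (fun i => ?_) i
    exact Fin.cases (hFP _ _ _) (fun i => hFP _ _ _) i
  have hall : ∀ i : Fin m × (Fin (m + 3) → Fin D), c i.1 i.2 ∈ F := by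
    rintro ⟨κ, α⟩
    refine hsolve F (fun e α => F.prod_mem fun i _ => F.pow_mem (hFq e i) _)
      (fun e => ln e κ.succ - σ e.2 * pt e 0 ^ D) (c κ)
      (fun e => F.sub_mem (hFP _ _ _) (F.mul_mem (hFσ _) (F.pow_mem (hFP _ _ _) _)))
      (fun e => ?_) (fun α hα => hg (Sum.inr (Sum.inr (κ, ⟨α, hα⟩)))) α
    rw [hinc e κ, lineCoord, add_sub_cancel_left]
    exact Finset.sum_congr rfl fun _ _ => mul_comm _ _
  have hle := hc.card_le_of_mem_closure g hall
  have hcard1 : Fintype.card {u : Fin m × Fin (m + 1) // u ≠ (a₀, κ₀)} + 1 = m * (m + 1) := by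
    have h := Fintype.card_subtype_compl (fun u : Fin m × Fin (m + 1) => u = (a₀, κ₀))
    simp only [Fintype.card_subtype_eq, Fintype.card_prod, Fintype.card_fin] at h
    have : 0 < m * (m + 1) := by positivity
    simp only [ne_eq]
    omega
  have hcard2 : Fintype.card {α : Fin (m + 3) → Fin D // α ∉ Set.range a} + s * (m + 1) =
      Fintype.card (Fin (m + 3) → Fin D) := by
    have h := Fintype.card_subtype_compl (fun α => α ∈ Set.range a)
    have h2 : Fintype.card {α // α ∈ Set.range a} = s * (m + 1) := by
      rw [← hcardE]
      exact Set.card_range_of_injective ha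
    have h3 := Fintype.card_subtype_le (fun α => α ∈ Set.range a)
    omega
  simp only [J, Fintype.card_prod, Fintype.card_sum, Fintype.card_fin] at hle
  rw [← hcard2] at hle
  nlinarith

theorem lineCoord_map {R S : Type*} [CommRing R] [CommRing S] {m D : ℕ} (φ : R →+* S)
    (c : Fin m → (Fin (m + 3) → Fin D) → R) (p : Fin (m + 1) → R) (b σ : R) (κ : Fin m) :
    φ (lineCoord c p b σ κ) =
      lineCoord (fun κ α => φ (c κ α)) (fun i => φ (p i)) (φ b) (φ σ) κ := by
  simp only [lineCoord, map_add, map_mul, map_pow, map_sum, map_prod]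
  congr 1
  refine Finset.sum_congr rfl fun α _ => ?_
  congr 1
  refine Finset.prod_congr rfl fun i _ => ?_
  congr 1
  refine Fin.cases rfl (fun i => ?_) i
  exact Fin.cases rfl (fun i => rfl) i

theorem Incident.map {R S : Type*} [CommRing R] [CommRing S] {m D : ℕ} (φ : R →+* S)
    {c : Fin m → (Fin (m + 3) → Fin D) → R} {p l : Fin (m + 1) → R} {σ : R}
    (h : Incident c p l σ) :
    Incident (fun κ α => φ (c κ α)) (fun i => φ (p i)) (fun i => φ (l i)) (φ σ) := by
  intro κ
  rw [← lineCoord_map, ← h κ]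

theorem Incident.of_map {R S : Type*} [CommRing R] [CommRing S] {m D : ℕ} {φ : R →+* S}
    (hφ : Function.Injective φ)
    {c : Fin m → (Fin (m + 3) → Fin D) → R} {p l : Fin (m + 1) → R} {σ : R}
    (h : Incident (fun κ α => φ (c κ α)) (fun i => φ (p i)) (fun i => φ (l i)) (φ σ)) :
    Incident c p l σ := by
  intro κ
  apply hφ
  rw [lineCoord_map]
  exact h κ

theorem exists_specialization_ne_zero {k L : Type*} [Field k] [IsAlgClosed k] [CharZero k]
    [Field L] [Algebra k L] {S T : Set L} (hS : S.Finite) (hT : T.Finite) (hT0 : ∀ t ∈ T, t ≠ 0)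
    {z : L} (hzS : z ∈ S) (hz : Transcendental k z) :
    ∃ (A : Subalgebra k L) (φ : A →ₐ[k] k), S ⊆ A ∧ (∀ t : A, (t : L) ∈ T → φ t ≠ 0) ∧
      ∃ n : ℕ, ∀ t : A, (t : L) = z → φ t = n := by
  let A := Algebra.adjoin k (S ∪ (·⁻¹) '' T)
  have hSA : S ⊆ A := Set.subset_union_left.trans Algebra.subset_adjoin
  have hA : A.FG := Subalgebra.fg_def.2 ⟨_, hS.union (hT.image _), rfl⟩
  have hz' : Transcendental k (⟨z, hSA hzS⟩ : A) := by
    intro h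
    exact hz (h.algHom A.val)
  obtain ⟨f, hf, hspec⟩ := exists_specialization A hA _ hz'
  have hinf : (Set.range fun n : ℕ => (n : k)).Infinite :=
    Set.infinite_range_of_injective Nat.cast_injective
  obtain ⟨_, ⟨n, rfl⟩, hn⟩ := hinf.exists_notMem_finite (Polynomial.finite_setOfPred_isRoot hf)
  obtain ⟨φ, hφ⟩ := hspec n hn
  refine ⟨A, φ, hSA, ?_, n, ?_⟩
  · intro t ht h
    have hinv : (t : L)⁻¹ ∈ A :=
      Algebra.subset_adjoin (Or.inr ⟨_, ht, rfl⟩)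
    have h1 : t * ⟨_, hinv⟩ = 1 := Subtype.ext (mul_inv_cancel₀ (hT0 _ ht))
    have h2 := congrArg φ h1
    rw [map_mul, h, zero_mul, map_one] at h2
    exact zero_ne_one h2
  · rintro ⟨t, ht⟩ rfl
    exact hφ

theorem exists_coloredPath_specialization {k L : Type*} [Field k] [IsAlgClosed k] [CharZero k]
    [Field L] [Algebra k L] {m D : ℕ} {c : Fin m → (Fin (m + 3) → Fin D) → k} {b : Bool}
    {σ : Fin (m + 1) → k} {V : Fin (m + 2) → Fin (m + 1) → L}
    (hV : IsColoredPath (fun κ α => algebraMap k L (c κ α)) b (fun j => algebraMap k L (σ j)) V)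
    (hnew : ∀ (a : Fin m) (w : Fin (m + 1) → k),
      V a.succ.castSucc ≠ fun i => algebraMap k L (w i))
    {a₀ : Fin m} {κ₀ : Fin (m + 1)} (hz : Transcendental k (V a₀.succ.castSucc κ₀))
    (U : Finset (Fin (m + 1) → k)) :
    ∃ v : Fin (m + 2) → Fin (m + 1) → k, IsColoredPath c b σ v ∧
      (∀ t w, V t = (fun i => algebraMap k L (w i)) → v t = w) ∧
      (∀ a : Fin m, v a.succ.castSucc ∉ U) ∧ ∃ n : ℕ, v a₀.succ.castSucc κ₀ = n := by
  let S : Set L := Set.range fun u : Fin (m + 2) × Fin (m + 1) => V u.1 u.2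
  let T₁ : Set L := Set.range fun u : Fin (m + 2) × Fin (m + 2) × Fin (m + 1) =>
    V u.1 u.2.2 - V u.2.1 u.2.2
  let T₂ : Set L := Set.range fun u : Fin (m + 2) × U × Fin (m + 1) =>
    V u.1 u.2.2 - algebraMap k L (u.2.1.1 u.2.2)
  obtain ⟨A, φ, hSA, hT, n, hn⟩ := exists_specialization_ne_zero (k := k) (S := S)
    (T := (T₁ ∪ T₂) \ {0}) (Set.finite_range _)
    (((Set.finite_range _).union (Set.finite_range _)).subset Set.sdiff_subset)
    (fun t ht => ht.2) (z := V a₀.succ.castSucc κ₀) ⟨(_, _), rfl⟩ hz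
  let V' : Fin (m + 2) → Fin (m + 1) → A := fun t κ => ⟨V t κ, hSA ⟨(t, κ), rfl⟩⟩
  refine ⟨fun t κ => φ (V' t κ), ⟨fun j => ?_, fun a a' hpar heq => ?_⟩, ?_, ?_, n, ?_⟩
  · have h1 : Incident (fun κ α => algebraMap k A (c κ α)) (V' (pointIdx b j))
        (V' (lineIdx b j)) (algebraMap k A (σ j)) :=
      Incident.of_map (φ := A.val.toRingHom) Subtype.val_injective (hV.incident j)
    have h2 := h1.map φ.toRingHom
    have h3 : ∀ r, φ.toRingHom (algebraMap k A r) = r := φ.commutes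
    simp only [h3] at h2
    exact h2
  · by_contra hne
    obtain ⟨i, hi⟩ := Function.ne_iff.1 (fun h => hne (hV.inj a a' hpar h))
    refine hT (V' a i - V' a' i) ⟨Or.inl ⟨(a, a', i), rfl⟩, sub_ne_zero.2 hi⟩ ?_
    rw [map_sub, sub_eq_zero]
    exact congrFun heq i
  · intro t w h
    ext i
    have : V' t i = algebraMap k A (w i) := Subtype.ext (congrFun h i)
    change φ (V' t i) = w i
    rw [this]
    exact φ.commutes _
  · intro a ha
    obtain ⟨i, hi⟩ := Function.ne_iff.1 (hnew a fun κ => φ (V' a.succ.castSucc κ))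
    refine hT (V' a.succ.castSucc i - algebraMap k A (φ (V' a.succ.castSucc i)))
      ⟨Or.inr ⟨(a.succ.castSucc, ⟨_, ha⟩, i), rfl⟩, sub_ne_zero.2 hi⟩ ?_
    rw [map_sub, AlgHom.commutes]
    exact sub_self _
  · exact hn _ rfl

theorem false_of_infinite_coloredPaths {k : Type} [Field k] [IsAlgClosed k] {m D : ℕ}
    (hm : 1 ≤ m) (hD : (3 * (m + 1) + 1) * (m + 1) ≤ D) {c : Fin m → (Fin (m + 3) → Fin D) → k}
    (hc : AlgebraicIndependent ℤ fun i : Fin m × (Fin (m + 3) → Fin D) => c i.1 i.2)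
    {b : Bool} {σ : Fin (m + 1) → k} {x y : Fin (m + 1) → k}
    {P : ℕ → Fin (m + 2) → Fin (m + 1) → k} (hP : ∀ i, IsColoredPath c b σ (P i))
    (hx : ∀ i, P i 0 = x) (hy : ∀ i, P i (Fin.last _) = y)
    (hdisj : ∀ i i', i ≠ i' → ∀ a : Fin m, P i a.succ.castSucc ≠ P i' a.succ.castSucc) :
    False := by
  have : CharZero k := (RingHom.charZero_iff hc.algebraMap_injective).1 inferInstance
  obtain ⟨K, _, φ, hφ0, hφ1⟩ := exists_ultraproduct fun _ => k
  let _ : Algebra k K := (φ.comp (Pi.constRingHom ℕ k)).toAlgebra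
  have hconst : ∀ r : k, algebraMap k K r = φ fun _ => r := fun r => rfl
  let V : Fin (m + 2) → Fin (m + 1) → K := fun t κ => φ fun j => P j t κ
  have hV : IsColoredPath (fun κ α => algebraMap k K (c κ α)) b
      (fun j => algebraMap k K (σ j)) V := by
    refine ⟨fun j => ?_, fun a a' hpar heq => ?_⟩
    · have h1 : Incident (fun κ α => (fun _ => c κ α : ℕ → k))
          (fun i j' => P j' (pointIdx b j) i) (fun i j' => P j' (lineIdx b j) i)
          (fun _ => σ j) := by
        intro κ
        ext j'
        have h2 := lineCoord_map (Pi.evalRingHom (fun _ : ℕ => k) j')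
          (fun κ α => (fun _ => c κ α : ℕ → k)) (fun i j' => P j' (pointIdx b j) i)
          (fun j' => P j' (lineIdx b j) 0) (fun _ => σ j) κ
        exact ((hP j').incident j κ).trans h2.symm
      exact h1.map φ
    · by_contra hne
      obtain ⟨i, hi⟩ := hφ1 (Fin (m + 1)) (fun i j => P j a i - P j a' i) <|
        Filter.Eventually.of_forall fun j => by
          obtain ⟨i, hi⟩ := Function.ne_iff.1 (fun h => hne ((hP j).inj a a' hpar h))
          exact ⟨i, sub_ne_zero.2 hi⟩
      apply hi
      have h1 : (fun j => P j a i - P j a' i) = (fun j => P j a i) - fun j => P j a' i := rfl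
      rw [h1, map_sub, sub_eq_zero]
      exact congrFun heq i
  have hnew : ∀ (a : Fin m) (w : Fin (m + 1) → k),
      V a.succ.castSucc ≠ fun i => algebraMap k K (w i) := by
    intro a w heq
    obtain ⟨i, hi⟩ := hφ1 (Fin (m + 1)) (fun i j => P j a.succ.castSucc i - w i) <| by
      by_cases h : ∃ j₀, P j₀ a.succ.castSucc = w
      · obtain ⟨j₀, hj₀⟩ := h
        filter_upwards [Filter.eventually_gt_atTop j₀] with j hj
        obtain ⟨i, hi⟩ := Function.ne_iff.1 (hj₀ ▸ hdisj j j₀ hj.ne' a)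
        exact ⟨i, sub_ne_zero.2 hi⟩
      · push Not at h
        refine Filter.Eventually.of_forall fun j => ?_
        obtain ⟨i, hi⟩ := Function.ne_iff.1 (h j)
        exact ⟨i, sub_ne_zero.2 hi⟩
    apply hi
    have h1 : (fun j => P j a.succ.castSucc i - w i) =
      (fun j => P j a.succ.castSucc i) - fun _ => w i := rfl
    rw [h1, map_sub, sub_eq_zero]
    exact congrFun heq i
  have hVx : V 0 = fun i => algebraMap k K (x i) := by
    ext i; simp only [V, hx, hconst]
  have hVy : V (Fin.last _) = fun i => algebraMap k K (y i) := by
    ext i; simp only [V, hy, hconst]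
  let a₀ : Fin m := ⟨0, hm⟩
  obtain ⟨κ₀, hz⟩ : ∃ κ₀, Transcendental k (V a₀.succ.castSucc κ₀) := by
    by_contra! h
    have h1 : ∀ κ, ∃ w, algebraMap k K w = V a₀.succ.castSucc κ := fun κ =>
      minpoly.mem_range_of_degree_eq_one k _ <| IsAlgClosed.degree_eq_one_of_irreducible k <|
        minpoly.irreducible (not_not.1 (h κ)).isIntegral
    choose w hw using h1
    exact hnew a₀ w (funext fun κ => (hw κ).symm)
  obtain ⟨f, hf, hfr⟩ := exists_seq_of_forall_finset_exists
    (fun v : Fin (m + 2) → Fin (m + 1) → k => IsColoredPath c b σ v ∧ v 0 = x ∧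
      v (Fin.last _) = y ∧ ∃ n : ℕ, v a₀.succ.castSucc κ₀ = n)
    (fun v w => ∀ a a' : Fin m, v a.succ.castSucc ≠ w a'.succ.castSucc) <| by
      classical
      intro s _
      obtain ⟨v, hv, hstd, hU, hn⟩ := exists_coloredPath_specialization hV hnew hz
        (s.biUnion fun v => Finset.univ.image fun a : Fin m => v a.succ.castSucc)
      refine ⟨v, ⟨hv, hstd _ _ hVx, hstd _ _ hVy, hn⟩, fun w hw a a' h => hU a' ?_⟩
      rw [← h]
      exact Finset.mem_biUnion.2 ⟨w, hw, Finset.mem_image_of_mem _ (Finset.mem_univ a)⟩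
  have := card_le_of_coloredPaths (s := 3 * (m + 1) + 1) (P := fun i => f i) hm hD hc
    (fun i => (hf i).1) (fun i => (hf i).2.1) (fun i => (hf i).2.2.1)
    (fun i i' hne a a' h => by
      rcases lt_or_gt_of_ne (Fin.val_ne_of_ne hne) with h' | h'
      · exact hfr _ _ h' a a' h
      · exact hfr _ _ h' a' a h.symm)
    (fun i => (hf i).2.2.2)
  omega

theorem exists_generic_reduction (I : Type) [Fintype I] :
    ∃ c : ∀ p : ℕ, I → ZMod p, ∀ g : MvPolynomial I ℤ, g ≠ 0 →
      ∀ᶠ p in atTop, MvPolynomial.aeval (c p) g ≠ 0 := by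
  classical
  have : Countable (MvPolynomial I ℤ) := by
    rw [← Cardinal.mk_le_aleph0_iff]
    exact (MvPolynomial.cardinalMk_le_max).trans (by simp)
  have : Nonempty {g : MvPolynomial I ℤ // g ≠ 0} := ⟨⟨1, one_ne_zero⟩⟩
  obtain ⟨e, he⟩ := exists_surjective_nat {g : MvPolynomial I ℤ // g ≠ 0}
  let Q : ℕ → ℕ → Prop := fun p i => ∃ c : I → ZMod p, ∀ j ≤ i,
    MvPolynomial.aeval c (e j).1 ≠ 0
  have hQ : ∀ i, ∀ᶠ p in atTop, Q p i := by
    intro i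
    have hne : ∏ j ∈ Finset.range (i + 1), (e j).1 ≠ 0 :=
      Finset.prod_ne_zero_iff.2 fun j _ => (e j).2
    obtain ⟨w, hw⟩ : ∃ w, MvPolynomial.aeval w (∏ j ∈ Finset.range (i + 1), (e j).1) ≠ (0 : ℤ) := by
      by_contra! h
      exact hne (MvPolynomial.funext fun w => by
        simpa [MvPolynomial.aeval_eq_eval] using h w)
    filter_upwards [eventually_gt_atTop
      (MvPolynomial.aeval w (∏ j ∈ Finset.range (i + 1), (e j).1)).natAbs] with p hp
    refine ⟨fun i => w i, fun j hj h => ?_⟩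
    have h1 : (((MvPolynomial.aeval w (e j).1 : ℤ)) : ZMod p) = 0 := by
      rw [← h]
      exact MvPolynomial.comp_aeval_apply (φ := (Int.castRingHom (ZMod p)).toIntAlgHom) w (e j).1
    rw [ZMod.intCast_zmod_eq_zero_iff_dvd] at h1
    have h2 : (p : ℤ) ∣ MvPolynomial.aeval w (∏ j ∈ Finset.range (i + 1), (e j).1) := by
      rw [map_prod]
      exact h1.trans (Finset.dvd_prod_of_mem _ (Finset.mem_range.2 (Nat.lt_succ_of_le hj)))
    have h3 := Nat.le_of_dvd (Int.natAbs_pos.2 hw) (Int.natCast_dvd.1 h2)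
    omega
  have hex : ∀ p, ∃ c : I → ZMod p, ∀ i ≤ p, Q p i → ∀ j ≤ i,
      MvPolynomial.aeval c (e j).1 ≠ 0 := by
    intro p
    by_cases h : ∃ i ≤ p, Q p i
    · obtain ⟨i, hi, hq⟩ := h
      obtain ⟨c, hc⟩ := Nat.findGreatest_spec (P := Q p) hi hq
      exact ⟨c, fun i' hi' hq' j hj => hc j (hj.trans (Nat.le_findGreatest hi' hq'))⟩
    · exact ⟨0, fun i hi hq => absurd ⟨i, hi, hq⟩ h⟩
  choose c hc using hex
  refine ⟨c, fun g hg => ?_⟩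
  obtain ⟨i, hi⟩ := he ⟨g, hg⟩
  filter_upwards [hQ i, eventually_ge_atTop i] with p h1 h2
  have := hc p i h2 h1 i le_rfl
  rwa [hi] at this

theorem eventually_not_coloredPaths {m D : ℕ} (hm : 1 ≤ m)
    (hD : (3 * (m + 1) + 1) * (m + 1) ≤ D)
    {c : ∀ p : ℕ, Fin m → (Fin (m + 3) → Fin D) → ZMod p}
    (hc : ∀ g : MvPolynomial (Fin m × (Fin (m + 3) → Fin D)) ℤ, g ≠ 0 →
      ∀ᶠ p in atTop, MvPolynomial.aeval (fun i => c p i.1 i.2) g ≠ 0) (b : Bool) :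
    ∀ᶠ C in atTop, ∀ p : ℕ, p.Prime → C ≤ p → ∀ (σ x y : Fin (m + 1) → ZMod p)
      (P : ℕ → Fin (m + 2) → Fin (m + 1) → ZMod p),
      (∀ i < C, IsColoredPath (c p) b σ (P i) ∧ P i 0 = x ∧ P i (Fin.last _) = y) →
      ∃ i < C, ∃ i' < C, i ≠ i' ∧ ∃ a : Fin m, P i a.succ.castSucc = P i' a.succ.castSucc := by
  suffices h : ∃ C, ∀ p : ℕ, p.Prime → C ≤ p → ∀ (σ x y : Fin (m + 1) → ZMod p)
      (P : ℕ → Fin (m + 2) → Fin (m + 1) → ZMod p),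
      (∀ i < C, IsColoredPath (c p) b σ (P i) ∧ P i 0 = x ∧ P i (Fin.last _) = y) →
      ∃ i < C, ∃ i' < C, i ≠ i' ∧ ∃ a : Fin m,
        P i a.succ.castSucc = P i' a.succ.castSucc by
    obtain ⟨C, hC⟩ := h
    filter_upwards [eventually_ge_atTop C] with C' hCC' p hp hpC σ x y P hP
    obtain ⟨i, hi, i', hi', h⟩ := hC p hp (hCC'.trans hpC) σ x y P
      fun i hi => hP i (hi.trans_le hCC')
    exact ⟨i, hi.trans_le hCC', i', hi'.trans_le hCC', h⟩
  by_contra! hcon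
  choose p hp hpC σ x y P hP hdisj using hcon
  have : ∀ j, Fact (p j).Prime := fun j => ⟨hp j⟩
  have hptop : Tendsto p atTop atTop := tendsto_atTop_mono hpC tendsto_id
  obtain ⟨K, _, φ, hφ0, hφ1⟩ := exists_ultraproduct fun j => ZMod (p j)
  let ψ : (∀ j, ZMod (p j)) →+* AlgebraicClosure K := (algebraMap K (AlgebraicClosure K)).comp φ
  have hψ0 : ∀ r r', (∀ᶠ j in atTop, r j = r' j) → ψ r = ψ r' := by
    intro r r' h
    rw [← sub_eq_zero, ← map_sub]
    change algebraMap _ _ (φ _) = 0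
    rw [hφ0, map_zero]
    filter_upwards [h] with j hj
    simp [hj]
  have hψ1 : ∀ r r' : Fin (m + 1) → ∀ j, ZMod (p j),
      (∀ᶠ j in atTop, (fun i => r i j) ≠ fun i => r' i j) →
      (fun i => ψ (r i)) ≠ fun i => ψ (r' i) := by
    intro r r' h heq
    obtain ⟨i, hi⟩ := hφ1 (Fin (m + 1)) (fun i => r i - r' i) <| by
      filter_upwards [h] with j hj
      obtain ⟨i, hi⟩ := Function.ne_iff.1 hj
      exact ⟨i, sub_ne_zero.2 hi⟩
    have h1 : ψ (r i) = ψ (r' i) := congrFun heq i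
    rw [← sub_eq_zero, ← map_sub] at h1
    exact hi ((algebraMap K (AlgebraicClosure K)).injective (h1.trans (map_zero _).symm))
  refine false_of_infinite_coloredPaths (k := AlgebraicClosure K) hm hD (b := b)
    (c := fun κ α => ψ fun j => c (p j) κ α) (σ := fun i => ψ fun j => σ j i)
    (x := fun i => ψ fun j => x j i) (y := fun i => ψ fun j => y j i)
    (P := fun i a κ => ψ fun j => P j i a κ) ?_ ?_ ?_ ?_ ?_
  · rw [algebraicIndependent_iff]
    intro g hg
    by_contra hne
    have h1 := MvPolynomial.comp_aeval_apply (φ := ψ.toIntAlgHom)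
      (fun (i : Fin m × (Fin (m + 3) → Fin D)) j => c (p j) i.1 i.2) g
    have h2 : φ (MvPolynomial.aeval
        (fun (i : Fin m × (Fin (m + 3) → Fin D)) j => c (p j) i.1 i.2) g) = 0 :=
      (algebraMap K (AlgebraicClosure K)).injective
        ((h1.trans hg).trans (map_zero _).symm)
    obtain ⟨_, hi⟩ := hφ1 Unit (fun _ => MvPolynomial.aeval
        (fun (i : Fin m × (Fin (m + 3) → Fin D)) j => c (p j) i.1 i.2) g) <| by
      filter_upwards [hptop.eventually (hc g hne)] with j hj
      refine ⟨(), fun h => hj ?_⟩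
      rw [← h]
      exact (MvPolynomial.comp_aeval_apply
        (φ := (Pi.evalRingHom (fun j => ZMod (p j)) j).toIntAlgHom)
        (fun (i : Fin m × (Fin (m + 3) → Fin D)) j => c (p j) i.1 i.2) g).symm
    exact hi h2
  · intro i
    refine ⟨fun a => ?_, fun a a' hpar heq => ?_⟩
    · intro κ
      refine Eq.trans ?_ (lineCoord_map ψ (fun κ α j => c (p j) κ α)
        (fun κ j => P j i (pointIdx b a) κ) (fun j => P j i (lineIdx b a) 0) (fun j => σ j a) κ)
      apply hψ0
      filter_upwards [eventually_gt_atTop i] with j hj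
      exact ((hP j i hj).1.incident a κ).trans
        (lineCoord_map (Pi.evalRingHom (fun j => ZMod (p j)) j) (fun κ α j => c (p j) κ α)
          (fun κ j => P j i (pointIdx b a) κ) (fun j => P j i (lineIdx b a) 0)
          (fun j => σ j a) κ).symm
    · by_contra hne
      refine hψ1 (fun κ j => P j i a κ) (fun κ j => P j i a' κ) ?_ heq
      filter_upwards [eventually_gt_atTop i] with j hj h
      exact hne ((hP j i hj).1.inj a a' hpar h)
  · intro i
    ext κ
    apply hψ0
    filter_upwards [eventually_gt_atTop i] with j hj
    rw [(hP j i hj).2.1]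
  · intro i
    ext κ
    apply hψ0
    filter_upwards [eventually_gt_atTop i] with j hj
    rw [(hP j i hj).2.2]
  · intro i i' hne a
    refine hψ1 (fun κ j => P j i a.succ.castSucc κ) (fun κ j => P j i' a.succ.castSucc κ) ?_
    filter_upwards [eventually_gt_atTop i, eventually_gt_atTop i'] with j hj hj'
    exact hdisj j i hj i' hj' hne a

theorem exists_coefficients {m D : ℕ} (hm : 1 ≤ m) (hD : (3 * (m + 1) + 1) * (m + 1) ≤ D) :
    ∃ C : ℕ, 1 ≤ C ∧ ∃ c : ∀ p : ℕ, Fin m → (Fin (m + 3) → Fin D) → ZMod p,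
      ∀ p : ℕ, p.Prime → C ≤ p → ∀ (b : Bool) (σ x y : Fin (m + 1) → ZMod p)
      (P : ℕ → Fin (m + 2) → Fin (m + 1) → ZMod p),
      (∀ i < C, IsColoredPath (c p) b σ (P i) ∧ P i 0 = x ∧ P i (Fin.last _) = y) →
      ∃ i < C, ∃ i' < C, i ≠ i' ∧ ∃ a : Fin m, P i a.succ.castSucc = P i' a.succ.castSucc := by
  obtain ⟨c, hc⟩ := exists_generic_reduction (Fin m × (Fin (m + 3) → Fin D))
  obtain ⟨C, h1, h2, h3⟩ := ((eventually_ge_atTop 1).and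
    ((eventually_not_coloredPaths (c := fun p κ α => c p (κ, α)) hm hD hc true).and
    (eventually_not_coloredPaths (c := fun p κ α => c p (κ, α)) hm hD hc false))).exists
  refine ⟨C, h1, fun p κ α => c p (κ, α), fun p hp hpC b => ?_⟩
  cases b
  · exact h3 p hp hpC
  · exact h2 p hp hpC

/-- The graph whose vertices are the points `(v, true)` and the lines `(v, false)`, with a point and
a line adjacent when they are joined by an edge with a colour in `S`. -/
def colorGraph {R : Type*} [CommRing R] {m D : ℕ} (c : Fin m → (Fin (m + 3) → Fin D) → R)
    (S : Finset R) : SimpleGraph ((Fin (m + 1) → R) × Bool) :=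
  SimpleGraph.fromRel fun u w => u.2 = true ∧ w.2 = false ∧ ∃ σ ∈ S, Incident c u.1 w.1 σ

theorem not_hasTheta_colorGraph {R : Type*} [CommRing R] {m D C : ℕ} (hC : 1 ≤ C)
    {c : Fin m → (Fin (m + 3) → Fin D) → R}
    (hc : ∀ (b : Bool) (σ x y : Fin (m + 1) → R) (P : ℕ → Fin (m + 2) → Fin (m + 1) → R),
      (∀ i < C, IsColoredPath c b σ (P i) ∧ P i 0 = x ∧ P i (Fin.last _) = y) →
      ∃ i < C, ∃ i' < C, i ≠ i' ∧ ∃ a : Fin m, P i a.succ.castSucc = P i' a.succ.castSucc)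
    {S : Finset R} (hS : S.Nonempty) {t : ℕ} (ht : C * S.card ^ (m + 1) ≤ t) :
    ¬ (colorGraph c S).HasTheta (m + 1) t := by
  classical
  rintro ⟨x, y, p, -, hx, hy, hinj, hadj, hdisj⟩
  have hadj' : ∀ i j, (p i (Fin.castSucc j)).2 = true ∧ (p i j.succ).2 = false ∧
        (∃ σ ∈ S, Incident c (p i j.castSucc).1 (p i j.succ).1 σ) ∨
      (p i j.succ).2 = true ∧ (p i j.castSucc).2 = false ∧
        ∃ σ ∈ S, Incident c (p i j.succ).1 (p i j.castSucc).1 σ :=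
    fun i j => ((SimpleGraph.fromRel_adj _ _ _).1 (hadj i j)).2
  have hside : ∀ i a, (p i a).2 = true ↔ (Even (a : ℕ) ↔ x.2 = true) := by
    intro i a
    induction a using Fin.induction with
    | zero => simp [hx]
    | succ a ih =>
      rw [Fin.val_succ, Nat.even_add_one]
      rw [Fin.val_castSucc] at ih
      rcases hadj' i a with ⟨h1, h2, -⟩ | ⟨h1, h2, -⟩ <;>
        simp only [h1, h2, Bool.false_eq_true] at ih ⊢ <;> tauto
  have hparity : ∀ i i' (a a' : Fin (m + 1 + 1)), (a : ℕ) % 2 = a' % 2 → (p i a).1 = (p i' a').1 →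
      p i a = p i' a' := by
    intro i i' a a' hpar h
    refine Prod.ext h (Bool.eq_iff_iff.2 ?_)
    rw [hside, hside, Nat.even_iff, Nat.even_iff, hpar]
  have hcol : ∀ i j, ∃ σ : S,
      Incident c (p i (pointIdx x.2 j)).1 (p i (lineIdx x.2 j)).1 (σ : R) := by
    intro i j
    have h := hside i j.castSucc
    rw [Fin.val_castSucc] at h
    rcases hadj' i j with ⟨h1, -, σ, hσ, h3⟩ | ⟨-, h1, σ, hσ, h3⟩
    · refine ⟨⟨σ, hσ⟩, ?_⟩
      rw [pointIdx, lineIdx, if_pos (h.1 h1), if_pos (h.1 h1)]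
      exact h3
    · refine ⟨⟨σ, hσ⟩, ?_⟩
      have h4 : ¬ (Even (j : ℕ) ↔ x.2 = true) := fun h5 => by simp [h1] at h; exact h h5
      rw [pointIdx, lineIdx, if_neg h4, if_neg h4]
      exact h3
  choose f hf using hcol
  have : Nonempty S := hS.to_subtype
  obtain ⟨σ, hσ⟩ := Fintype.exists_le_card_fiber_of_mul_le_card (n := C) f <| by
    simpa [mul_comm] using ht
  obtain ⟨F, hF, hFC⟩ := Finset.exists_subset_card_eq hσ
  let e := F.equivFinOfCardEq hFC
  let q : ℕ → Fin t := fun i => e.symm ⟨i % C, Nat.mod_lt _ hC⟩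
  have hq : ∀ i, f (q i) = σ := fun i =>
    (Finset.mem_filter.1 (hF (e.symm ⟨i % C, Nat.mod_lt _ hC⟩).2)).2
  obtain ⟨i, hi, i', hi', hne, a, ha⟩ := hc x.2 (fun j => σ j) x.1 y.1
    (fun i a => (p (q i) a).1) fun i _ => by
      refine ⟨⟨fun j => ?_, fun a a' hpar h => ?_⟩, ?_, ?_⟩
      · have := hf (q i) j
        rwa [hq] at this
      · exact hinj _ (hparity _ _ _ _ hpar h)
      · simp only [hx]
      · simp only [hy]
  have hqne : q i ≠ q i' := by
    intro h
    have := e.symm.injective (Subtype.ext h)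
    rw [Fin.mk.injEq, Nat.mod_eq_of_lt hi, Nat.mod_eq_of_lt hi'] at this
    exact hne this
  rcases hdisj _ _ hqne _ _ (hparity _ _ _ _ rfl ha) with h | h
  · have := hinj _ (h.trans (hx (q i)).symm)
    simp [Fin.ext_iff] at this
  · have h1 := hinj _ (h.trans (hy (q i)).symm)
    have := a.2
    simp only [Fin.ext_iff, Fin.val_castSucc, Fin.val_succ, Fin.val_last] at h1
    omega

theorem exists_polynomial_lineCoord {R : Type*} [CommRing R] {m D : ℕ}
    (c : Fin m → (Fin (m + 3) → Fin D) → R) (p : Fin m → R) (b σ : R) (κ : Fin m) :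
    ∃ f : Polynomial R, f.natDegree ≤ D ∧ f.coeff D = σ ∧
      ∀ z, f.eval z = lineCoord c (Fin.cons z p) b σ κ := by
  let g : Polynomial R := ∑ α : Fin (m + 3) → Fin D,
    Polynomial.C (c κ α * (σ ^ (α 0 : ℕ) * (b ^ (α 1 : ℕ) *
      ∏ i, p i ^ (α i.succ.succ.succ : ℕ)))) * Polynomial.X ^ (α 2 : ℕ)
  have hg : g.degree < D := by
    rw [← Polynomial.mem_degreeLT]
    refine Submodule.sum_mem _ fun α _ => Polynomial.mem_degreeLT.2 ?_
    exact (Polynomial.degree_C_mul_X_pow_le _ _).trans_lt (by exact_mod_cast (α 2).2)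
  refine ⟨Polynomial.C σ * Polynomial.X ^ D + g, ?_, ?_, fun z => ?_⟩
  · exact Polynomial.natDegree_add_le_of_degree_le (Polynomial.natDegree_C_mul_X_pow_le _ _)
      (Polynomial.natDegree_le_of_degree_le hg.le)
  · rw [Polynomial.coeff_add, Polynomial.coeff_C_mul_X_pow, if_pos rfl,
      Polynomial.coeff_eq_zero_of_degree_lt hg, add_zero]
  · rw [lineCoord, Polynomial.eval_add, Polynomial.eval_finsetSum]
    congr 1
    · simp
    · refine Finset.sum_congr rfl fun α _ => ?_
      rw [Fin.prod_univ_succ, Fin.prod_univ_succ, Fin.prod_univ_succ]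
      simp only [Fin.cons_zero, Fin.cons_succ, Polynomial.eval_mul, Polynomial.eval_C,
        Polynomial.eval_pow, Polynomial.eval_X]
      have h1 : (1 : Fin (m + 3)) = Fin.succ 0 := rfl
      have h2 : (2 : Fin (m + 3)) = Fin.succ (Fin.succ 0) := rfl
      rw [h1, h2]
      ring

theorem card_filter_lineCoord_ne {R : Type*} [Field R] [Fintype R] [DecidableEq R] {m D : ℕ}
    (c : Fin m → (Fin (m + 3) → Fin D) → R) (p : Fin m → R) (b : R) (κ : Fin m) (S : Finset R) :
    Fintype.card R - S.card ^ 2 * D ≤ (Finset.univ.filter fun z =>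
      ∀ σ ∈ S, ∀ σ' ∈ S, lineCoord c (Fin.cons z p) b σ κ = lineCoord c (Fin.cons z p) b σ' κ →
        σ = σ').card := by
  choose f hf1 hf2 hf3 using fun σ => exists_polynomial_lineCoord c p b σ κ
  rw [tsub_le_iff_right, ← Finset.card_univ]
  refine (Finset.card_le_card (t := _ ∪
    S.offDiag.biUnion fun u => (f u.1 - f u.2).roots.toFinset) ?_).trans
      ((Finset.card_union_le _ _).trans (Nat.add_le_add_left ?_ _))
  · intro z _
    rw [Finset.mem_union, Finset.mem_filter]
    by_contra! h
    obtain ⟨h1, h2⟩ := h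
    obtain ⟨σ, hσ, σ', hσ', heq, hne⟩ := h1 (Finset.mem_univ _)
    refine h2 (Finset.mem_biUnion.2 ⟨(σ, σ'), Finset.mem_offDiag.2 ⟨hσ, hσ', hne⟩, ?_⟩)
    rw [Multiset.mem_toFinset, Polynomial.mem_roots', Polynomial.IsRoot.def, Polynomial.eval_sub,
      hf3, hf3, heq]
    refine ⟨fun h => hne ?_, sub_self _⟩
    have := congrArg (fun g => g.coeff D) h
    simpa [hf2, sub_eq_zero] using this
  · refine Finset.card_biUnion_le.trans ((Finset.sum_le_card_nsmul _ _ D fun u _ => ?_).trans ?_)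
    · exact (Multiset.toFinset_card_le _).trans ((Polynomial.card_roots' _).trans
        ((Polynomial.natDegree_sub_le _ _).trans (max_le (hf1 _) (hf1 _))))
    · rw [Finset.offDiag_card, smul_eq_mul, sq]
      exact Nat.mul_le_mul_right _ (Nat.sub_le _ _)

theorem le_card_edgeSet_colorGraph {R : Type*} [Field R] [Fintype R] {m D : ℕ} (hm : 1 ≤ m)
    (c : Fin m → (Fin (m + 3) → Fin D) → R) (S : Finset R) :
    Fintype.card R ^ (m + 1) * (Fintype.card R - S.card ^ 2 * D) * S.card ≤
      Nat.card (colorGraph c S).edgeSet := by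
  classical
  let κ : Fin m := ⟨0, hm⟩
  let T : Finset (Σ _ : (Fin m → R) × R, R) := Finset.univ.sigma fun u =>
    Finset.univ.filter fun z =>
    ∀ σ ∈ S, ∀ σ' ∈ S, lineCoord c (Fin.cons z u.1) u.2 σ κ =
      lineCoord c (Fin.cons z u.1) u.2 σ' κ → σ = σ'
  have hT : Fintype.card R ^ (m + 1) * (Fintype.card R - S.card ^ 2 * D) ≤ T.card := by
    rw [Finset.card_sigma]
    refine le_trans (le_of_eq ?_) (Finset.card_nsmul_le_sum _ _ _ fun u _ =>
      card_filter_lineCoord_ne c u.1 u.2 κ S)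
    simp [pow_succ]
  let line : (Σ _ : (Fin m → R) × R, R) × R → Fin (m + 1) → R := fun v =>
    Fin.cons v.1.1.2 fun κ => lineCoord c (Fin.cons v.1.2 v.1.1.1) v.1.1.2 v.2 κ
  let edge : (Σ _ : (Fin m → R) × R, R) × R → Sym2 ((Fin (m + 1) → R) × Bool) := fun v =>
    s((Fin.cons v.1.2 v.1.1.1, true), (line v, false))
  have hinj : Set.InjOn edge (T ×ˢ S : Finset _) := by
    rintro ⟨⟨⟨p, b⟩, z⟩, σ⟩ hv ⟨⟨⟨p', b'⟩, z'⟩, σ'⟩ hv' h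
    simp only [edge, line, Sym2.eq_iff, Prod.mk.injEq, Bool.true_eq_false, and_false, and_true,
      or_false, Bool.false_eq_true] at h
    obtain ⟨h1, h2⟩ := h
    obtain ⟨rfl, rfl⟩ := Fin.cons_injective2 h1
    obtain ⟨rfl, h3⟩ := Fin.cons_injective2 h2
    simp only [T, Finset.coe_product, Set.mem_prod, Finset.mem_coe, Finset.mem_sigma,
      Finset.mem_filter, Finset.mem_univ, true_and] at hv hv'
    rw [hv.1 σ hv.2 σ' hv'.2 (congrFun h3 κ)]
  have hsub : ((T ×ˢ S).image edge : Set (Sym2 ((Fin (m + 1) → R) × Bool))) ⊆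
      (colorGraph c S).edgeSet := by
    intro u hu
    obtain ⟨v, hv, rfl⟩ := Finset.mem_image.1 (Finset.mem_coe.1 hu)
    rw [SimpleGraph.mem_edgeSet, colorGraph, SimpleGraph.fromRel_adj]
    exact ⟨fun h => by simpa using congrArg Prod.snd h, Or.inl ⟨rfl, rfl, v.2,
      (Finset.mem_product.1 hv).2, fun κ => rfl⟩⟩
  calc _ ≤ T.card * S.card := Nat.mul_le_mul_right _ hT
    _ = ((T ×ˢ S).image edge).card := by
      rw [Finset.card_image_of_injOn hinj, Finset.card_product]
    _ ≤ (colorGraph c S).edgeSet.ncard := by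
      rw [← Set.ncard_coe_finset]
      exact Set.ncard_le_ncard hsub
    _ = _ := rfl

theorem SimpleGraph.HasTheta.of_map {V W : Type*} {G : SimpleGraph V} {f : V ↪ W} {ℓ t : ℕ}
    (hℓ : 1 ≤ ℓ) (ht : 1 ≤ t) (h : (G.map f).HasTheta ℓ t) : G.HasTheta ℓ t := by
  obtain ⟨x, y, p, hne, hx, hy, hinj, hadj, hdisj⟩ := h
  have hex : ∀ i j, ∃ v, f v = p i j := by
    intro i j
    refine Fin.lastCases ?_ (fun j => ?_) j
    · obtain ⟨_, v, -, -, hv⟩ := (SimpleGraph.map_adj _ _ _ _).1 (hadj i ⟨ℓ - 1, by omega⟩)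
      refine ⟨v, hv.trans (congrArg (p i) (Fin.ext ?_))⟩
      simp only [Fin.val_succ, Fin.val_last]
      omega
    · obtain ⟨v, _, -, hv, -⟩ := (SimpleGraph.map_adj _ _ _ _).1 (hadj i j)
      exact ⟨v, hv⟩
  choose q hq using hex
  have hqp : ∀ i j i' j', q i j = q i' j' ↔ p i j = p i' j' := by
    intro i j i' j'
    rw [← hq, ← hq, f.injective.eq_iff]
  let i₀ : Fin t := ⟨0, ht⟩
  have hqx : ∀ i, q i 0 = q i₀ 0 := fun i => by rw [hqp, hx, hx]
  have hqy : ∀ i, q i (Fin.last ℓ) = q i₀ (Fin.last ℓ) := fun i => by rw [hqp, hy, hy]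
  refine ⟨q i₀ 0, q i₀ (Fin.last ℓ), q, ?_, hqx, hqy, fun i j j' h => hinj i ((hqp _ _ _ _).1 h),
    fun i j => ?_, fun i i' hi j j' h => ?_⟩
  · rw [Ne, hqp, hx, hy]
    exact hne
  · rw [← SimpleGraph.map_adj_apply (f := f), hq, hq]
    exact hadj i j
  · rw [hqp, hqp, hx, hy]
    exact hdisj i i' hi j j' ((hqp _ _ _ _).1 h)

theorem SimpleGraph.card_edgeSet_map {V W : Type*} (G : SimpleGraph V) (f : V ↪ W) :
    Nat.card (G.map f).edgeSet = Nat.card G.edgeSet := by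
  rw [SimpleGraph.edgeSet_map]
  exact Nat.card_image_of_injective f.sym2Map.injective _

theorem Nat.exists_mul_pow_le_lt {ℓ C t : ℕ} (hℓ : ℓ ≠ 0) (hC : 1 ≤ C) (ht : C ≤ t) :
    ∃ r, 1 ≤ r ∧ C * r ^ ℓ ≤ t ∧ t < C * (r + 1) ^ ℓ := by
  have hex : ∃ r, t < C * (r + 1) ^ ℓ := by
    refine ⟨t, (Nat.lt_succ_self t).trans_le ?_⟩
    calc t + 1 ≤ (t + 1) ^ ℓ := Nat.le_self_pow hℓ _
      _ ≤ C * (t + 1) ^ ℓ := Nat.le_mul_of_pos_left _ hC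
  classical
  have h1 : Nat.find hex ≠ 0 := by
    intro h
    have := Nat.find_spec hex
    rw [h] at this
    simp at this
    omega
  refine ⟨Nat.find hex, by omega, ?_, Nat.find_spec hex⟩
  have := Nat.find_min hex (m := Nat.find hex - 1) (by omega)
  rwa [not_lt, Nat.sub_add_cancel (by omega)] at this

theorem Nat.exists_prime_two_mul_pow_le {ℓ n : ℕ} (hℓ : ℓ ≠ 0) (hn : 2 * 2 ^ ℓ ≤ n) :
    ∃ p, p.Prime ∧ 2 * p ^ ℓ ≤ n ∧ n ≤ (4 * p) ^ ℓ := by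
  have : 1 ≤ 2 ^ ℓ := Nat.one_le_two_pow
  obtain ⟨r, hr1, hr2, hr3⟩ := Nat.exists_mul_pow_le_lt (C := 2) (t := n) hℓ (by omega) (by omega)
  have hr : 2 ≤ r := by
    by_contra h
    have : r = 1 := by omega
    subst this
    norm_num at hr3
    omega
  obtain ⟨p, hp, h1, h2⟩ := Nat.exists_prime_lt_and_le_two_mul (r / 2) (by omega)
  refine ⟨p, hp, le_trans ?_ hr2, hr3.le.trans ?_⟩
  · gcongr
    omega
  · calc 2 * (r + 1) ^ ℓ ≤ 2 ^ ℓ * (2 * p) ^ ℓ := by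
          gcongr
          · exact Nat.le_self_pow hℓ 2
          · omega
      _ = (4 * p) ^ ℓ := by rw [← mul_pow, ← mul_assoc]; norm_num

theorem Real.natCast_rpow_one_div_le {ℓ a b : ℕ} (hℓ : ℓ ≠ 0) (h : a ≤ b ^ ℓ) :
    (a : ℝ) ^ (1 / (ℓ : ℝ)) ≤ b := by
  calc (a : ℝ) ^ (1 / (ℓ : ℝ)) ≤ ((b : ℝ) ^ ℓ) ^ (1 / (ℓ : ℝ)) := by
        gcongr
        exact_mod_cast h
    _ = b := by
      rw [one_div]
      exact Real.pow_rpow_inv_natCast (Nat.cast_nonneg b) hℓ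

/-- For every fixed even `ℓ ≥ 2` there are `c > 0` and `t₀` such that for every `t ≥ t₀`
there is `n₀` such that for every `n ≥ n₀` there is a `Θ_{ℓ,t}`-free graph on `n`
vertices with at least `c · t^{1/ℓ} · n^{1+1/ℓ}` edges. -/
theorem theta_turan_lower_even (ℓ : ℕ) (hℓ : 2 ≤ ℓ) (heven : Even ℓ) :
    ∃ c : ℝ, 0 < c ∧ ∃ t0 : ℕ, ∀ t : ℕ, t0 ≤ t → ∃ n0 : ℕ, ∀ n : ℕ, n0 ≤ n →
      ∃ G : SimpleGraph (Fin n), ¬ G.HasTheta ℓ t ∧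
        c * (t : ℝ) ^ (1 / (ℓ : ℝ)) * (n : ℝ) ^ (1 + 1 / (ℓ : ℝ))
          ≤ (Nat.card G.edgeSet : ℝ) := by
  obtain ⟨m, rfl⟩ : ∃ m, ℓ = m + 1 := ⟨ℓ - 1, by omega⟩
  have hm : 1 ≤ m := by omega
  obtain ⟨D, hD⟩ : ∃ D, D = (3 * (m + 1) + 1) * (m + 1) := ⟨_, rfl⟩
  obtain ⟨C, hC, c, hc⟩ := exists_coefficients hm hD.ge
  have hD1 : 1 ≤ D := by rw [hD]; exact Nat.mul_pos (by omega) (by omega)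
  have hC0 : (0 : ℝ) < C := by exact_mod_cast hC
  refine ⟨1 / (4 * C * 4 ^ (m + 2)), by positivity, C, fun t ht => ?_⟩
  obtain ⟨s, hs1, hst, hts⟩ := Nat.exists_mul_pow_le_lt (ℓ := m + 1) (by omega) hC ht
  refine ⟨2 * 2 ^ (m + 1) + (4 * (C + 2 * (s ^ 2 * D))) ^ (m + 1), fun n hn => ?_⟩
  obtain ⟨p, hp, hpn, hnp⟩ := Nat.exists_prime_two_mul_pow_le (ℓ := m + 1) (n := n) (by omega)
    (by omega)
  have hbig : C + 2 * (s ^ 2 * D) ≤ p := by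
    have := lt_of_pow_lt_pow_left₀ (m + 1) (Nat.zero_le _)
      (lt_of_lt_of_le (by have : 0 < 2 ^ (m + 1) := by positivity
                          omega) (hn.trans hnp) :
        (4 * (C + 2 * (s ^ 2 * D))) ^ (m + 1) < (4 * p) ^ (m + 1))
    omega
  have hsp : s ≤ p := by
    have : s ≤ s ^ 2 * D := (Nat.le_self_pow two_ne_zero s).trans (Nat.le_mul_of_pos_right _ hD1)
    omega
  have : Fact p.Prime := ⟨hp⟩
  obtain ⟨S, -, hS⟩ := Finset.exists_subset_card_eq
    (s := (Finset.univ : Finset (ZMod p))) (n := s) (by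
      rwa [Finset.card_univ, ZMod.card])
  have hcardV : Fintype.card ((Fin (m + 1) → ZMod p) × Bool) ≤ Fintype.card (Fin n) := by
    rw [Fintype.card_prod, Fintype.card_fun, ZMod.card, Fintype.card_fin, Fintype.card_fin,
      Fintype.card_bool, mul_comm]
    exact hpn
  obtain ⟨e⟩ := Function.Embedding.nonempty_of_card_le hcardV
  refine ⟨(colorGraph (c p) S).map e, fun h => ?_, ?_⟩
  · refine not_hasTheta_colorGraph hC (hc p hp (by omega))
      (Finset.card_pos.1 (hs1.trans_eq hS.symm)) (t := t) (by rwa [hS])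
      (h.of_map (by omega) (by omega))
  · rw [SimpleGraph.card_edgeSet_map]
    have hedge := le_card_edgeSet_colorGraph hm (c p) S
    rw [ZMod.card, hS] at hedge
    have h1 : p ^ (m + 2) * s ≤ 2 * Nat.card (colorGraph (c p) S).edgeSet := by
      calc p ^ (m + 2) * s = p ^ (m + 1) * p * s := by rw [pow_succ p (m + 1)]
        _ ≤ p ^ (m + 1) * (2 * (p - s ^ 2 * D)) * s := by
          gcongr
          omega
        _ = 2 * (p ^ (m + 1) * (p - s ^ 2 * D) * s) := by ring
        _ ≤ _ := Nat.mul_le_mul_left 2 hedge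
    have h2 : (t : ℝ) ^ (1 / ((m + 1 : ℕ) : ℝ)) ≤ ((C * (2 * s) : ℕ) : ℝ) := by
      refine Real.natCast_rpow_one_div_le (by omega) (hts.le.trans ?_)
      rw [mul_pow]
      gcongr
      · exact Nat.le_self_pow (by omega) C
      · omega
    have h3 : (n : ℝ) ^ (1 + 1 / ((m + 1 : ℕ) : ℝ)) ≤ (4 * p : ℝ) ^ (m + 2) := by
      rw [Real.rpow_add' (Nat.cast_nonneg n) (by positivity), Real.rpow_one, pow_succ]
      have h4 := Real.natCast_rpow_one_div_le (by omega) hnp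
      push_cast at h4 ⊢
      gcongr
      exact_mod_cast hnp
    calc _ ≤ 1 / (4 * C * 4 ^ (m + 2)) * ((C * (2 * s) : ℕ) : ℝ) * (4 * p : ℝ) ^ (m + 2) := by
          gcongr
      _ = ((p ^ (m + 2) * s : ℕ) : ℝ) / 2 := by
          push_cast
          field_simp
          ring
      _ ≤ ((2 * Nat.card (colorGraph (c p) S).edgeSet : ℕ) : ℝ) / 2 := by
          gcongr
      _ = _ := by push_cast; ring
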